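/- Let p ≥ 1 and let α be a complex number with Re(α) > p-1. Then ∫_{X > 0} det(X)^{α-p} e^{-tr(X)} dμ_p(X) = π^{p(p-1)/2} ∏_{j=1}^p Γ(α - j + 1), where the integral is over the cone of positive definite matrices in Herm(p) and det(X)^{α-p} is the complex power of the positive real number det(X). -/

import Mathlib

open MeasureTheory Matrix
open scoped ComplexOrder

noncomputable section

/-- Parameter space `ℝ^p × ℂ^{p(p-1)/2}` for `p × p` Hermitian matrices:
the real diagonal entries together with the strictly upper-triangular complex entries. -/
abbrev HermParam (p : ℕ) : Type :=
  (Fin p → ℝ) × ({ q : Fin p × Fin p // q.1 < q.2 } → ℂ)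

/-- The linear isomorphism sending the parameters to the corresponding self-adjoint matrix. -/
def toHermMatrix (p : ℕ) (T : HermParam p) : Matrix (Fin p) (Fin p) ℂ :=
  Matrix.of fun i j =>
    if h : i < j then T.2 ⟨(i, j), h⟩
    else if h' : j < i then (starRingEnd ℂ) (T.2 ⟨(j, i), h'⟩)
    else (T.1 i : ℂ)

noncomputable instance matrixComplexMeasureSpace (m n : ℕ) :
    MeasureSpace (Matrix (Fin m) (Fin n) ℂ) :=
  inferInstanceAs (MeasureSpace (Fin m → Fin n → ℂ))

/-- The Lebesgue measure `μ_p` on Herm(p), realized as a measure on the space of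
`p × p` complex matrices: the pushforward of Lebesgue measure on the parameter space
under the linear isomorphism `toHermMatrix p`. -/
def hermLebesgue (p : ℕ) : Measure (Matrix (Fin p) (Fin p) ℂ) :=
  Measure.map (toHermMatrix p) volume

/-- The complex matrix-variate gamma function
`Γ̃_p(α) = π^{p(p-1)/2} ∏_{j=1}^p Γ(α - j + 1) = π^{p(p-1)/2} ∏_{j=0}^{p-1} Γ(α - j)`. -/
def cGammaP (p : ℕ) (α : ℂ) : ℂ :=
  (Real.pi : ℂ) ^ (p * (p - 1) / 2) * ∏ j : Fin p, Complex.Gamma (α - j)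

end

noncomputable section

section BorderedMatrix

variable {n : Type*} [Fintype n]

/-- The Hermitian matrix with corner `d`, first row `b` and Schur complement `A`. -/
def borderedMatrix (d : ℝ) (b : n → ℂ) (A : Matrix n n ℂ) : Matrix (Unit ⊕ n) (Unit ⊕ n) ℂ :=
  fromBlocks (of fun _ _ => (d : ℂ)) (of fun _ j => b j) (of fun i _ => star (b i))
    (A + of fun i j => star (b i) * b j / d)

lemma trace_borderedMatrix (d : ℝ) (b : n → ℂ) (A : Matrix n n ℂ) :
    (borderedMatrix d b A).trace = d + A.trace + ∑ i, ((‖b i‖ ^ 2 / d : ℝ) : ℂ) := by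
  simp [borderedMatrix, trace, Complex.conj_mul', Finset.sum_add_distrib, add_assoc]

variable [DecidableEq n]

/-- The unipotent factor in the block LDL decomposition of `borderedMatrix`. -/
def borderedUnipotent (d : ℝ) (b : n → ℂ) : Matrix (Unit ⊕ n) (Unit ⊕ n) ℂ :=
  fromBlocks 1 (of fun _ j => b j / d) 0 1

lemma borderedMatrix_eq_conj {d : ℝ} (hd : d ≠ 0) (b : n → ℂ) (A : Matrix n n ℂ) :
    borderedMatrix d b A = star (borderedUnipotent d b) *
      fromBlocks (of fun _ _ => (d : ℂ)) 0 0 A * borderedUnipotent d b := by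
  have hd' : (d : ℂ) ≠ 0 := by exact_mod_cast hd
  rw [borderedMatrix, borderedUnipotent, star_eq_conjTranspose, fromBlocks_conjTranspose,
    fromBlocks_multiply, fromBlocks_multiply]
  congr 1
  · ext i j
    simp
  · ext i j
    simp [Matrix.mul_apply, mul_div_cancel₀ _ hd']
  · ext i j
    simp [Matrix.mul_apply, hd']
  · ext i j
    simp [Matrix.mul_apply, hd', add_comm, mul_div_assoc]

lemma det_borderedUnipotent (d : ℝ) (b : n → ℂ) : (borderedUnipotent d b).det = 1 := by
  simp [borderedUnipotent]

lemma det_borderedMatrix {d : ℝ} (hd : d ≠ 0) (b : n → ℂ) (A : Matrix n n ℂ) :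
    (borderedMatrix d b A).det = d * A.det := by
  rw [borderedMatrix_eq_conj hd, det_mul, det_mul, star_eq_conjTranspose, det_conjTranspose,
    det_borderedUnipotent, det_fromBlocks_zero₂₁]
  simp

lemma posDef_fromBlocks_diagonal {d : ℝ} {A : Matrix n n ℂ} (hd : 0 < d) :
    (fromBlocks (of fun _ _ => (d : ℂ)) 0 0 A : Matrix (Unit ⊕ n) (Unit ⊕ n) ℂ).PosDef ↔
      A.PosDef := by
  have hD : (of fun _ _ => (d : ℂ) : Matrix Unit Unit ℂ) = diagonal fun _ => (d : ℂ) := by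
    ext; simp
  have hDpos : (of fun _ _ => (d : ℂ) : Matrix Unit Unit ℂ).PosDef := by
    rw [hD, posDef_diagonal_iff]
    exact fun _ => by exact_mod_cast hd
  refine ⟨fun h => h.submatrix Sum.inr_injective, fun h => ?_⟩
  let := hDpos.isUnit.invertible
  have hs := (PosDef.fromBlocks₁₁ (0 : Matrix Unit n ℂ) A hDpos).2 (by simpa using h.posSemidef)
  rw [conjTranspose_zero] at hs
  rw [hs.posDef_iff_det_ne_zero, det_fromBlocks_zero₂₁]
  exact mul_ne_zero hDpos.det_pos.ne' h.det_pos.ne'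

lemma posDef_borderedMatrix_iff (d : ℝ) (b : n → ℂ) (A : Matrix n n ℂ) :
    (borderedMatrix d b A).PosDef ↔ 0 < d ∧ A.PosDef := by
  have key (hd : 0 < d) : (borderedMatrix d b A).PosDef ↔ A.PosDef := by
    rw [borderedMatrix_eq_conj hd.ne', IsUnit.posDef_star_left_conjugate_iff,
      posDef_fromBlocks_diagonal hd]
    rw [isUnit_iff_isUnit_det, det_borderedUnipotent]
    exact isUnit_one
  refine ⟨fun h => ?_, fun h => (key h.1).2 h.2⟩
  have hd : 0 < d := by
    have : 0 < borderedMatrix d b A (.inl ()) (.inl ()) := h.diag_pos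
    simpa [borderedMatrix] using this
  exact ⟨hd, (key hd).1 h⟩

end BorderedMatrix

section Parametrization

/-- Strictly upper-triangular index pairs of size `p + 1` are those of the first row together
with those of size `p`. -/
def upperPairEquiv (p : ℕ) :
    Fin p ⊕ { q : Fin p × Fin p // q.1 < q.2 } ≃
      { q : Fin (p + 1) × Fin (p + 1) // q.1 < q.2 } :=
  Equiv.ofBijective
    (Sum.elim (fun i => ⟨(0, i.succ), Fin.succ_pos i⟩)
      fun q => ⟨(q.1.1.succ, q.1.2.succ), Fin.succ_lt_succ_iff.2 q.2⟩) <| by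
    constructor
    · rintro (i | ⟨⟨i, j⟩, h⟩) (i' | ⟨⟨i', j'⟩, h'⟩) <;>
        simp [Fin.succ_ne_zero, (Fin.succ_ne_zero _).symm]
    · rintro ⟨⟨i, j⟩, h⟩
      induction j using Fin.cases with
      | zero => exact absurd h (Fin.not_lt_zero i)
      | succ j =>
        induction i using Fin.cases with
        | zero => exact ⟨.inl j, rfl⟩
        | succ i => exact ⟨.inr ⟨(i, j), Fin.succ_lt_succ_iff.1 h⟩, rfl⟩

/-- The index equivalence splitting off the first row and column. -/
def unitSumFinEquiv (p : ℕ) : Unit ⊕ Fin p ≃ Fin (p + 1) :=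
  Equiv.ofBijective (Sum.elim (fun _ => 0) Fin.succ) <| by
    constructor
    · rintro (i | i) (j | j) <;> simp [Fin.succ_ne_zero, (Fin.succ_ne_zero _).symm]
    · intro i
      induction i using Fin.cases with
      | zero => exact ⟨.inl (), rfl⟩
      | succ i => exact ⟨.inr i, rfl⟩

@[simp] lemma unitSumFinEquiv_inl (p : ℕ) (u : Unit) : unitSumFinEquiv p (.inl u) = 0 := rfl

@[simp] lemma unitSumFinEquiv_inr (p : ℕ) (i : Fin p) : unitSumFinEquiv p (.inr i) = i.succ := rfl

/-- Assemble the parameters of a Hermitian matrix of size `p + 1` from the corner entry, the rest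
of the first row, and the parameters of the remaining block. -/
def consHermParam (p : ℕ) (z : (ℝ × (Fin p → ℂ)) × HermParam p) : HermParam (p + 1) :=
  (Fin.cons z.1.1 z.2.1, fun q => Sum.elim z.1.2 z.2.2 ((upperPairEquiv p).symm q))

/-- The parameters of the rank one matrix `b* b / d`. -/
def rankOneHermParam (p : ℕ) (x : ℝ × (Fin p → ℂ)) : HermParam p :=
  (fun i => ‖x.2 i‖ ^ 2 / x.1, fun q => star (x.2 q.1.1) * x.2 q.1.2 / x.1)

lemma toHermMatrix_add (p : ℕ) (S T : HermParam p) :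
    toHermMatrix p (S + T) = toHermMatrix p S + toHermMatrix p T := by
  ext i j
  simp only [toHermMatrix, of_apply, Matrix.add_apply]
  split_ifs <;> simp

lemma toHermMatrix_rankOneHermParam (p : ℕ) (x : ℝ × (Fin p → ℂ)) :
    toHermMatrix p (rankOneHermParam p x) = of fun i j => star (x.2 i) * x.2 j / x.1 := by
  ext i j
  simp only [toHermMatrix, rankOneHermParam, of_apply]
  split_ifs with h h'
  · rfl
  · simp [mul_comm]
  · obtain rfl := le_antisymm (not_lt.1 h') (not_lt.1 h)
    simp [Complex.conj_mul']

lemma toHermMatrix_consHermParam (p : ℕ) (x : ℝ × (Fin p → ℂ)) (T : HermParam p) :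
    (toHermMatrix (p + 1) (consHermParam p (x, T + rankOneHermParam p x))).submatrix
      (unitSumFinEquiv p) (unitSumFinEquiv p) = borderedMatrix x.1 x.2 (toHermMatrix p T) := by
  have hl (j : Fin p) (h : (0 : Fin (p + 1)) < j.succ) :
      (upperPairEquiv p).symm ⟨(0, j.succ), h⟩ = .inl j := by
    rw [Equiv.symm_apply_eq]; rfl
  have hr (i j : Fin p) (h : i.succ < j.succ) :
      (upperPairEquiv p).symm ⟨(i.succ, j.succ), h⟩ =
        .inr ⟨(i, j), Fin.succ_lt_succ_iff.1 h⟩ := by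
    rw [Equiv.symm_apply_eq]; rfl
  rw [borderedMatrix, ← toHermMatrix_rankOneHermParam, ← toHermMatrix_add]
  ext (i | i) (j | j)
  · simp [toHermMatrix, consHermParam]
  · simp [toHermMatrix, consHermParam, hl]
  · simp [toHermMatrix, consHermParam, hl]
  · simp [toHermMatrix, consHermParam, hr]

lemma toHermMatrix_injective (p : ℕ) : Function.Injective (toHermMatrix p) := by
  intro S T h
  refine Prod.ext (funext fun i => ?_) (funext fun q => ?_)
  · simpa [toHermMatrix] using congrFun₂ h i i
  · simpa [toHermMatrix, q.2] using congrFun₂ h q.1.1 q.1.2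

lemma measurable_toHermMatrix (p : ℕ) : Measurable (toHermMatrix p) := by
  refine measurable_pi_iff.2 fun i => measurable_pi_iff.2 fun j => ?_
  simp only [toHermMatrix, of_apply]
  split_ifs
  · fun_prop
  · exact Complex.continuous_conj.measurable.comp (by fun_prop)
  · fun_prop

lemma measurableEmbedding_toHermMatrix (p : ℕ) : MeasurableEmbedding (toHermMatrix p) := by
  have : MeasurableSpace.CountablySeparated (Matrix (Fin p) (Fin p) ℂ) :=
    inferInstanceAs (MeasurableSpace.CountablySeparated (Fin p → Fin p → ℂ))
  exact (measurable_toHermMatrix p).measurableEmbedding (toHermMatrix_injective p)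

end Parametrization

section MeasurePreserving

lemma measurePreserving_prodProdProdComm {A B C D : Type*} [MeasurableSpace A] [MeasurableSpace B]
    [MeasurableSpace C] [MeasurableSpace D] (μ : Measure A) (ν : Measure B) (ρ : Measure C)
    (τ : Measure D) [SigmaFinite μ] [SigmaFinite ν] [SigmaFinite ρ] [SigmaFinite τ] :
    MeasurePreserving (fun z : (A × B) × (C × D) => ((z.1.1, z.2.1), (z.1.2, z.2.2)))
      ((μ.prod ν).prod (ρ.prod τ)) ((μ.prod ρ).prod (ν.prod τ)) := by
  have h₁ := measurePreserving_prodAssoc μ ν (ρ.prod τ)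
  have h₂ := (MeasurePreserving.id μ).prod (measurePreserving_prodAssoc ν ρ τ).symm
  have h₃ := (MeasurePreserving.id μ).prod
    ((Measure.measurePreserving_swap (μ := ν) (ν := ρ)).prod (MeasurePreserving.id τ))
  have h₄ := (MeasurePreserving.id μ).prod (measurePreserving_prodAssoc ρ ν τ)
  have h₅ := (measurePreserving_prodAssoc μ ρ (ν.prod τ)).symm
  exact h₅.comp (h₄.comp (h₃.comp (h₂.comp h₁)))

lemma measurePreserving_consHermParam (p : ℕ) :
    MeasurePreserving (consHermParam p) volume volume := by
  have hswap := measurePreserving_prodProdProdComm (volume : Measure ℝ)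
    (volume : Measure (Fin p → ℂ)) (volume : Measure (Fin p → ℝ))
    (volume : Measure ({ q : Fin p × Fin p // q.1 < q.2 } → ℂ))
  have hdiag := (volume_preserving_piFinSuccAbove (fun _ : Fin (p + 1) => ℝ) 0).symm
  have hupper := (volume_measurePreserving_piCongrLeft
    (fun _ : { q : Fin (p + 1) × Fin (p + 1) // q.1 < q.2 } => ℂ) (upperPairEquiv p)).comp
    (volume_measurePreserving_sumPiEquivProdPi_symm
      fun _ : Fin p ⊕ { q : Fin p × Fin p // q.1 < q.2 } => ℂ)
  have h := (hdiag.prod hupper).comp hswap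
  suffices h_eq : consHermParam p = _ from h_eq ▸ h
  funext z
  refine Prod.ext ?_ (funext fun q => ?_)
  · simp [consHermParam, Function.comp_def, MeasurableEquiv.piFinSuccAbove_symm_apply,
      Fin.insertNthEquiv]
  · obtain ⟨q, rfl⟩ := (upperPairEquiv p).surjective q
    simp only [consHermParam, Equiv.symm_apply_apply, Function.comp_apply, Prod.map_apply,
      MeasurableEquiv.piCongrLeft_apply_apply]
    rcases q with q | q <;> rfl

lemma consHermParam_injective (p : ℕ) : Function.Injective (consHermParam p) := by
  rintro ⟨⟨d, b⟩, S⟩ ⟨⟨d', b'⟩, S'⟩ h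
  obtain ⟨h₁, h₂⟩ := Prod.ext_iff.1 h
  obtain ⟨hd, hS⟩ := Fin.cons_injective2 (α := fun _ => ℝ) h₁
  have h₃ (q) := congrFun h₂ (upperPairEquiv p q)
  simp only [consHermParam, Equiv.symm_apply_apply] at h₃
  exact Prod.ext (Prod.ext hd (funext fun i => h₃ (.inl i)))
    (Prod.ext hS (funext fun q => h₃ (.inr q)))

lemma measurable_rankOneHermParam (p : ℕ) : Measurable (rankOneHermParam p) := by
  unfold rankOneHermParam
  refine Measurable.prodMk (by fun_prop) (measurable_pi_iff.2 fun q => ?_)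
  refine Measurable.div (Measurable.mul ?_ (by fun_prop)) (by fun_prop)
  exact Complex.continuous_conj.measurable.comp (by fun_prop)

/-- Parametrization of Hermitian matrices by the first row and the Schur complement. -/
def schurParam (p : ℕ) (z : (ℝ × (Fin p → ℂ)) × HermParam p) : HermParam (p + 1) :=
  consHermParam p (z.1, z.2 + rankOneHermParam p z.1)

lemma measurePreserving_schurParam (p : ℕ) : MeasurePreserving (schurParam p) volume volume := by
  refine (measurePreserving_consHermParam p).comp
    ((MeasurePreserving.id volume).skew_product
      (g := fun x (T : HermParam p) => T + rankOneHermParam p x) ?_ (.of_forall fun x => ?_))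
  · exact measurable_snd.add ((measurable_rankOneHermParam p).comp measurable_fst)
  · have : (volume : Measure (HermParam p)).IsAddLeftInvariant :=
      Measure.prod.instIsAddLeftInvariant
    simp_rw [add_comm _ (rankOneHermParam p x)]
    exact map_add_left_eq_self _ _

lemma measurableEmbedding_schurParam (p : ℕ) : MeasurableEmbedding (schurParam p) := by
  refine (measurePreserving_schurParam p).measurable.measurableEmbedding fun z w h => ?_
  obtain ⟨h₁, h₂⟩ := Prod.ext_iff.1 (consHermParam_injective p h)
  refine Prod.ext h₁ ?_
  dsimp only at h₁ h₂
  rw [h₁] at h₂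
  exact add_right_cancel h₂

end MeasurePreserving

section Integrals

lemma integral_prod_exp_neg_norm_sq_div {p : ℕ} {x : ℝ} (hx : 0 < x) :
    ∫ b : Fin p → ℂ, ∏ i, Real.exp (-(‖b i‖ ^ 2 / x)) = Real.pi ^ p * x ^ p := by
  have h : ∫ z : ℂ, Real.exp (-(‖z‖ ^ 2 / x)) = Real.pi * x := by
    have := Complex.integral_exp_neg_mul_rpow one_le_two (inv_pos.2 hx)
    have hpow : (x⁻¹ : ℝ) ^ (-2 / 2 : ℝ) = x := by
      rw [neg_div, div_self two_ne_zero, Real.rpow_neg_one, inv_inv]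
    rw [hpow, div_self two_ne_zero, one_add_one_eq_two, Real.Gamma_two, mul_one] at this
    simpa [div_eq_inv_mul] using this
  rw [integral_fintype_prod_volume_eq_pow (fun z : ℂ => Real.exp (-(‖z‖ ^ 2 / x))), h,
    Fintype.card_fin, mul_pow]

lemma integrable_prod_exp_neg_norm_sq_div {p : ℕ} {x : ℝ} (hx : 0 < x) :
    Integrable fun b : Fin p → ℂ => ∏ i, Real.exp (-(‖b i‖ ^ 2 / x)) := by
  refine .of_integral_ne_zero ?_
  rw [integral_prod_exp_neg_norm_sq_div hx]
  positivity

lemma ofReal_mul_cpow {d : ℝ} (hd : 0 < d) (z s : ℂ) :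
    ((d : ℂ) * z) ^ s = (d : ℂ) ^ s * z ^ s := by
  have hd' : (d : ℂ) ≠ 0 := by exact_mod_cast hd.ne'
  rcases eq_or_ne z 0 with rfl | hz
  · rcases eq_or_ne s 0 with rfl | hs
    · simp
    · simp [Complex.zero_cpow hs]
  · rw [Complex.cpow_def_of_ne_zero (mul_ne_zero hd' hz), Complex.cpow_def_of_ne_zero hd',
      Complex.cpow_def_of_ne_zero hz, Complex.log_ofReal_mul hd hz, Complex.ofReal_log hd.le,
      add_mul, Complex.exp_add]

lemma ofReal_cpow_mul_pow {x : ℝ} (hx : 0 < x) (s : ℂ) (p : ℕ) :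
    (x : ℂ) ^ (s - (p + 1)) * (x : ℂ) ^ p = (x : ℂ) ^ (s - 1) := by
  rw [← Complex.cpow_natCast, ← Complex.cpow_add _ _ (by exact_mod_cast hx.ne')]
  congr 1
  ring

lemma integral_gamma_mul_gaussian (p : ℕ) {s : ℂ} (hs : 0 < s.re) :
    ∫ z : ℝ × (Fin p → ℂ) in Set.Ioi 0 ×ˢ Set.univ,
      ((z.1 : ℂ) ^ (s - (p + 1)) * Real.exp (-z.1)) *
        ((∏ i, Real.exp (-(‖z.2 i‖ ^ 2 / z.1)) : ℝ) : ℂ) = Real.pi ^ p * Complex.Gamma s := by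
  have hnorm (x : ℝ) (hx : 0 < x) (y : Fin p → ℂ) :
      ‖((x : ℂ) ^ (s - (p + 1)) * Real.exp (-x)) *
        ((∏ i, Real.exp (-(‖y i‖ ^ 2 / x)) : ℝ) : ℂ)‖ =
      ‖(x : ℂ) ^ (s - (p + 1)) * Real.exp (-x)‖ * ∏ i, Real.exp (-(‖y i‖ ^ 2 / x)) := by
    rw [norm_mul, Complex.norm_of_nonneg]
    positivity
  have hint : Integrable (fun z : ℝ × (Fin p → ℂ) =>
      ((z.1 : ℂ) ^ (s - (p + 1)) * Real.exp (-z.1)) *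
        ((∏ i, Real.exp (-(‖z.2 i‖ ^ 2 / z.1)) : ℝ) : ℂ))
      ((volume.restrict (Set.Ioi 0)).prod volume) := by
    refine (integrable_prod_iff (Measurable.aestronglyMeasurable (by fun_prop))).2 ⟨?_, ?_⟩
    · filter_upwards [ae_restrict_mem measurableSet_Ioi] with x hx
      exact (integrable_prod_exp_neg_norm_sq_div hx).ofReal.const_mul _
    · refine ((Complex.GammaIntegral_convergent hs).norm.mul_const (Real.pi ^ p)).congr ?_
      filter_upwards [ae_restrict_mem measurableSet_Ioi] with x (hx : 0 < x)
      simp_rw [hnorm x hx, integral_const_mul, integral_prod_exp_neg_norm_sq_div hx]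
      rw [← ofReal_cpow_mul_pow hx s p]
      simp [abs_of_pos hx]
      ring
  rw [Measure.volume_eq_prod, ← Measure.prod_restrict, Measure.restrict_univ,
    integral_prod _ hint, Complex.Gamma_eq_integral hs, Complex.GammaIntegral,
    ← integral_const_mul]
  refine setIntegral_congr_fun measurableSet_Ioi fun x (hx : 0 < x) => ?_
  simp only [integral_const_mul, integral_complex_ofReal, integral_prod_exp_neg_norm_sq_div hx]
  rw [← ofReal_cpow_mul_pow hx s p]
  push_cast
  ring

/-- The integrand of the complex matrix-variate gamma function. -/
def hermGammaIntegrand {n : Type*} [Fintype n] [DecidableEq n] (s : ℂ) (X : Matrix n n ℂ) : ℂ :=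
  (X.det.re : ℂ) ^ s * Real.exp (-X.trace.re)

lemma posDef_submatrix_equiv_iff {m n : Type*} [Fintype m] [Fintype n] (e : m ≃ n)
    {X : Matrix n n ℂ} : (X.submatrix e e).PosDef ↔ X.PosDef :=
  ⟨fun h => by simpa [submatrix_submatrix] using h.submatrix e.symm.injective,
    fun h => h.submatrix e.injective⟩

lemma hermGammaIntegrand_submatrix {m n : Type*} [Fintype m] [DecidableEq m] [Fintype n]
    [DecidableEq n] (e : m ≃ n) (s : ℂ) (X : Matrix n n ℂ) :
    hermGammaIntegrand s (X.submatrix e e) = hermGammaIntegrand s X := by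
  have : (X.submatrix e e).trace = X.trace := e.sum_comp fun i => X i i
  rw [hermGammaIntegrand, hermGammaIntegrand, det_submatrix_equiv_self, this]

lemma hermGammaIntegrand_borderedMatrix {n : Type*} [Fintype n] [DecidableEq n] (s : ℂ) {d : ℝ}
    (hd : 0 < d) (b : n → ℂ) (A : Matrix n n ℂ) :
    hermGammaIntegrand s (borderedMatrix d b A) =
      (d : ℂ) ^ s * Real.exp (-d) * ((∏ i, Real.exp (-(‖b i‖ ^ 2 / d)) : ℝ) : ℂ) *
        hermGammaIntegrand s A := by
  rw [hermGammaIntegrand, det_borderedMatrix hd.ne', trace_borderedMatrix,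
    Complex.re_ofReal_mul, Complex.ofReal_mul, ofReal_mul_cpow hd,
    ← Complex.ofReal_sum, Complex.add_re, Complex.add_re, Complex.ofReal_re, Complex.ofReal_re,
    ← Real.exp_sum, Finset.sum_neg_distrib, neg_add, neg_add, Real.exp_add, Real.exp_add,
    hermGammaIntegrand]
  push_cast
  ring

lemma setIntegral_hermGammaIntegrand_succ (p : ℕ) (s : ℂ) (hs : 0 < s.re) :
    ∫ T in {T | (toHermMatrix (p + 1) T).PosDef},
        hermGammaIntegrand (s - (p + 1)) (toHermMatrix (p + 1) T) =
      Real.pi ^ p * Complex.Gamma s *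
        ∫ T in {T | (toHermMatrix p T).PosDef},
          hermGammaIntegrand (s - (p + 1)) (toHermMatrix p T) := by
  have hset : schurParam p ⁻¹' {T | (toHermMatrix (p + 1) T).PosDef} =
      (Set.Ioi 0 ×ˢ Set.univ) ×ˢ {T | (toHermMatrix p T).PosDef} := by
    ext ⟨x, T⟩
    rw [Set.mem_preimage, Set.mem_ofPred_eq, ← posDef_submatrix_equiv_iff (unitSumFinEquiv p),
      schurParam, toHermMatrix_consHermParam, posDef_borderedMatrix_iff]
    simp
  rw [← (measurePreserving_schurParam p).setIntegral_preimage_emb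
    (measurableEmbedding_schurParam p), hset, ← integral_gamma_mul_gaussian p hs,
    ← setIntegral_prod_mul, Measure.volume_eq_prod]
  refine integral_congr_ae ?_
  have hpos := ae_restrict_of_ae_restrict_of_subset
    (Set.prod_mono_right (Set.subset_univ {T | (toHermMatrix p T).PosDef}))
    (ae_restrict_mem (μ := (volume : Measure ((ℝ × (Fin p → ℂ)) × HermParam p)))
      (((measurableSet_Ioi (a := (0 : ℝ))).prod .univ).prod .univ))
  filter_upwards [hpos] with z hz
  rw [schurParam, ← hermGammaIntegrand_submatrix (unitSumFinEquiv p), toHermMatrix_consHermParam,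
    hermGammaIntegrand_borderedMatrix _ hz.1.1]

lemma setIntegral_hermGammaIntegrand (p : ℕ) : ∀ α : ℂ, (p - 1 : ℝ) < α.re →
    ∫ T in {T | (toHermMatrix p T).PosDef}, hermGammaIntegrand (α - p) (toHermMatrix p T) =
      (Real.pi : ℂ) ^ (p * (p - 1) / 2) * ∏ j : Fin p, Complex.Gamma (α - j) := by
  induction p with
  | zero =>
    intro α _
    have : {T : HermParam 0 | (toHermMatrix 0 T).PosDef} = Set.univ :=
      Set.eq_univ_of_forall fun T => by
        rw [Set.mem_ofPred_eq, Subsingleton.elim (toHermMatrix 0 T) 1]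
        exact PosDef.one
    rw [this]
    simp [hermGammaIntegrand, trace, Measure.volume_eq_prod, volume_pi, measureReal_def,
      ← Set.univ_prod_univ, Measure.prod_prod]
  | succ p ih =>
    intro α hα
    push_cast at hα ⊢
    have hp : (0 : ℝ) ≤ p := p.cast_nonneg
    have htri : (p + 1) * p / 2 = p * (p - 1) / 2 + p := Nat.triangle_succ p
    have hexp : α - ((p : ℂ) + 1) = α - 1 - p := by ring
    rw [setIntegral_hermGammaIntegrand_succ p α (by linarith), hexp,
      ih (α - 1) (by rw [Complex.sub_re, Complex.one_re]; linarith), htri, pow_add,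
      Fin.prod_univ_succ]
    have hprod : ∏ j : Fin p, Complex.Gamma (α - ((j.succ : Fin (p + 1)) : ℕ)) =
        ∏ j : Fin p, Complex.Gamma (α - 1 - (j : ℕ)) :=
      Finset.prod_congr rfl fun j _ => by rw [Fin.val_succ]; push_cast; ring_nf
    rw [hprod, Fin.val_zero, Nat.cast_zero, sub_zero]
    ring

end Integrals

end

theorem stmt6 (p : ℕ) (hp : 1 ≤ p) (α : ℂ) (hα : (p - 1 : ℝ) < α.re) :
    ∫ X in {X : Matrix (Fin p) (Fin p) ℂ | X.PosDef},
      ((X.det.re : ℂ) ^ (α - p) * Real.exp (-X.trace.re)) ∂(hermLebesgue p)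
    = (Real.pi : ℂ) ^ (p * (p - 1) / 2) * ∏ j : Fin p, Complex.Gamma (α - j) := by
  rw [hermLebesgue, (measurableEmbedding_toHermMatrix p).setIntegral_map]
  exact setIntegral_hermGammaIntegrand p α hα
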